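/- Let E be a systematic linear [k+d−1, k, d]_q code with encoding x ↦ (x, p_0·x, p_1·x, ..., p_{d−2}·x) for vectors p_0,...,p_{d−2} ∈ F_q^k (such a code is MDS). Let 1 ≤ r ≤ k, let t = ⌈k/r⌉, and let [k] = S_1 ⊔ ... ⊔ S_t be a partition into nonempty sets of size at most r. Then the pyramid code C with encoding x ↦ (x, p_0|_{S_1}·x|_{S_1}, ..., p_0|_{S_t}·x|_{S_t}, p_1·x, ..., p_{d−2}·x) is a linear [n, k, d]_q code with n = k + ⌈k/r⌉ + d − 2, it has information locality r, and moreover its first k + ⌈k/r⌉ coordinates all have locality at most r. -/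

import Mathlib

open Matrix Finset

/-- The Hamming weight of the codeword encoding `x` under the code with points `c`
    (indexed by an arbitrary finite type). -/
def codewordWeight {ι : Type} [Fintype ι] {k : ℕ} {F : Type} [Field F] [DecidableEq F]
    (c : ι → Fin k → F) (x : Fin k → F) : ℕ :=
  (Finset.univ.filter fun i : ι => c i ⬝ᵥ x ≠ 0).card

/-- The code determined by the points `c` has minimum distance `d`. -/
def HasDistance {ι : Type} [Fintype ι] {k : ℕ} {F : Type} [Field F] [DecidableEq F]
    (c : ι → Fin k → F) (d : ℕ) : Prop :=
  (∀ x : Fin k → F, x ≠ 0 → d ≤ codewordWeight c x) ∧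
  (∃ x : Fin k → F, x ≠ 0 ∧ codewordWeight c x = d)

/-- `loc(c_i) ≤ r`: the point `c i` is a linear combination of at most `r` other points. -/
def LocLE {ι : Type} [DecidableEq ι] {k : ℕ} {F : Type} [Field F]
    (c : ι → Fin k → F) (i : ι) (r : ℕ) : Prop :=
  ∃ R : Finset ι, i ∉ R ∧ R.card ≤ r ∧
    ∃ lam : ι → F, c i = ∑ j ∈ R, lam j • c j

/-- The code has information locality `r`: some spanning subset of points has locality ≤ r. -/
def InfoLocality {ι : Type} [DecidableEq ι] {k : ℕ} {F : Type} [Field F]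
    (c : ι → Fin k → F) (r : ℕ) : Prop :=
  ∃ I : Set ι, Submodule.span F (c '' I) = ⊤ ∧ ∀ i ∈ I, LocLE c i r

section CodewordWeight

variable {ι κ : Type} [Fintype ι] [Fintype κ] {k : ℕ} {F : Type} [Field F] [DecidableEq F]

lemma codewordWeight_eq_sum (c : ι → Fin k → F) (x : Fin k → F) :
    codewordWeight c x = ∑ i, if c i ⬝ᵥ x ≠ 0 then 1 else 0 :=
  Finset.card_filter _ _

lemma codewordWeight_sumElim (a : ι → Fin k → F) (b : κ → Fin k → F) (x : Fin k → F) :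
    codewordWeight (Sum.elim a b) x = codewordWeight a x + codewordWeight b x := by
  simp only [codewordWeight_eq_sum, Fintype.sum_sum_type, Sum.elim_inl, Sum.elim_inr]
  rfl

lemma codewordWeight_fin_succ {n : ℕ} (p : Fin (n + 1) → Fin k → F) (x : Fin k → F) :
    codewordWeight p x =
      (if p 0 ⬝ᵥ x ≠ 0 then 1 else 0) + codewordWeight (fun m : Fin n => p m.succ) x := by
  simp only [codewordWeight_eq_sum, Fin.sum_univ_succ]

lemma codewordWeight_le_card (c : ι → Fin k → F) (x : Fin k → F) :
    codewordWeight c x ≤ Fintype.card ι :=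
  Finset.card_le_univ _

lemma codewordWeight_eq_card_iff (c : ι → Fin k → F) (x : Fin k → F) :
    codewordWeight c x = Fintype.card ι ↔ ∀ i, c i ⬝ᵥ x ≠ 0 := by
  rw [codewordWeight, Finset.card_eq_iff_eq_univ, Finset.filter_eq_self.trans]
  all_goals simp

lemma codewordWeight_basis_single (i : Fin k) :
    codewordWeight (fun j : Fin k => (Pi.single j 1 : Fin k → F)) (Pi.single i 1) = 1 := by
  simp [codewordWeight_eq_sum, Pi.single_apply]

/-- In a systematic code with `m` parity points and distance at least `m + 1`, all coordinates of
the parity points are nonzero. -/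
lemma parity_apply_ne_zero (p : ι → Fin k → F)
    (h : ∀ x : Fin k → F, x ≠ 0 → Fintype.card ι + 1 ≤
      codewordWeight (Sum.elim (fun i : Fin k => (Pi.single i 1 : Fin k → F)) p) x)
    (m : ι) (i : Fin k) : p m i ≠ 0 := by
  have hi := h (Pi.single i 1) (by simp)
  rw [codewordWeight_sumElim, codewordWeight_basis_single] at hi
  have hle := codewordWeight_le_card p (Pi.single i 1)
  simpa using (codewordWeight_eq_card_iff p (Pi.single i 1)).1 (by omega) m

end CodewordWeight

section Restriction

variable {ι : Type} [Fintype ι] {k : ℕ} {F : Type} [Field F]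

/-- The restriction of a vector to a set of coordinates, extended by zero. -/
def restrictCoords (s : Finset (Fin k)) (v : Fin k → F) : Fin k → F :=
  fun j => if j ∈ s then v j else 0

lemma restrictCoords_eq_sum (s : Finset (Fin k)) (v : Fin k → F) :
    restrictCoords s v = ∑ j ∈ s, v j • (Pi.single j 1 : Fin k → F) := by
  ext a
  simp [restrictCoords, Finset.sum_apply, Pi.single_apply]

lemma sum_restrictCoords {S : ι → Finset (Fin k)} (hS : ∀ j, ∃! l, j ∈ S l) (v : Fin k → F) :
    ∑ l, restrictCoords (S l) v = v := by
  ext j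
  obtain ⟨l, hl, huniq⟩ := hS j
  rw [Finset.sum_apply, Fintype.sum_eq_single l]
  · simp [restrictCoords, hl]
  · intro l' hne
    have : j ∉ S l' := fun h => hne (huniq l' h)
    simp [restrictCoords, this]

variable [DecidableEq F]

lemma le_codewordWeight_restrictCoords {S : ι → Finset (Fin k)} (hS : ∀ j, ∃! l, j ∈ S l)
    (v x : Fin k → F) :
    (if v ⬝ᵥ x ≠ 0 then 1 else 0) ≤ codewordWeight (fun l => restrictCoords (S l) v) x := by
  split_ifs with h
  · rw [← sum_restrictCoords hS v, sum_dotProduct] at h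
    obtain ⟨l, -, hl⟩ := Finset.exists_ne_zero_of_sum_ne_zero h
    exact Finset.card_pos.2 ⟨l, by simpa using hl⟩
  · exact Nat.zero_le _

lemma codewordWeight_restrictCoords_single_le {S : ι → Finset (Fin k)} (hS : ∀ j, ∃! l, j ∈ S l)
    (v : Fin k → F) (i : Fin k) :
    codewordWeight (fun l => restrictCoords (S l) v) (Pi.single i 1) ≤ 1 := by
  refine Finset.card_le_one.2 fun a ha b hb => ?_
  simp only [restrictCoords, dotProduct_single, mul_one, Finset.mem_filter, Finset.mem_univ,
    true_and, ne_eq, ite_eq_right_iff, Classical.not_imp] at ha hb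
  exact (hS i).unique ha.1 hb.1

end Restriction

section Locality

variable {ι κ : Type} [DecidableEq ι] [DecidableEq κ] {k : ℕ} {F : Type} [Field F]

lemma locLE_restrictCoords (c : Fin k ⊕ κ → Fin k → F)
    (hc : ∀ i, c (Sum.inl i) = Pi.single i 1) {s : Finset (Fin k)} {v : Fin k → F} {l : κ}
    (hl : c (Sum.inr l) = restrictCoords s v) : LocLE c (Sum.inr l) s.card := by
  refine ⟨s.map Function.Embedding.inl, by simp, by simp, Sum.elim v 0, ?_⟩
  simp [hl, hc, restrictCoords_eq_sum]

lemma locLE_single (c : Fin k ⊕ κ → Fin k → F)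
    (hc : ∀ i, c (Sum.inl i) = Pi.single i 1) {s : Finset (Fin k)} {v : Fin k → F} {l : κ}
    (hl : c (Sum.inr l) = restrictCoords s v) {i : Fin k} (hi : i ∈ s) (hv : v i ≠ 0) :
    LocLE c (Sum.inl i) s.card := by
  refine ⟨(s.erase i).disjSum {l}, by simp, ?_,
    Sum.elim (fun j => -((v i)⁻¹ * v j)) (fun _ => (v i)⁻¹), ?_⟩
  · have := Finset.card_pos.2 ⟨i, hi⟩
    rw [Finset.card_disjSum, Finset.card_erase_of_mem hi, Finset.card_singleton]
    omega
  · rw [Finset.sum_disjSum]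
    simp only [hc, hl, Sum.elim_inl, Sum.elim_inr, Finset.sum_singleton, restrictCoords_eq_sum,
      ← Finset.add_sum_erase s _ hi, smul_add, Finset.smul_sum, smul_smul, neg_smul,
      Finset.sum_neg_distrib, inv_mul_cancel₀ hv, one_smul]
    abel

lemma LocLE.mono {c : ι → Fin k → F} {i : ι} {r r' : ℕ} (h : LocLE c i r) (hr : r ≤ r') :
    LocLE c i r' :=
  let ⟨R, hi, hR, hlam⟩ := h
  ⟨R, hi, hR.trans hr, hlam⟩

lemma span_range_single : Submodule.span F
    (Set.range fun i : Fin k => (Pi.single i 1 : Fin k → F)) = ⊤ := by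
  convert (Pi.basisFun F (Fin k)).span_eq using 3
  ext i : 1
  simp

end Locality

/-- The pyramid code construction: given a systematic MDS [k+d−1,k,d] code `E` with parity
    vectors `p_0, ..., p_{d−2}` and a partition `S_1 ⊔ ... ⊔ S_t` of `[k]` into nonempty
    sets of size at most `r` (t = ⌈k/r⌉), the pyramid code — whose points are the `e_i`,
    the restrictions `p_0|_{S_l}`, and `p_1, ..., p_{d−2}` — is a linear [n,k,d] code with
    n = k + ⌈k/r⌉ + d − 2, has information locality r, and its first k + ⌈k/r⌉
    coordinates all have locality at most r. -/
theorem pyramid_code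
    {F : Type} [Field F] [Fintype F] [DecidableEq F]
    {k d r t : ℕ} (hd : 2 ≤ d) (hr1 : 1 ≤ r) (hrk : r ≤ k) (hk : 1 ≤ k)
    (ht : t = (k + r - 1) / r)
    (p : Fin (d - 1) → Fin k → F)
    (hE : HasDistance (Sum.elim (fun i : Fin k => (Pi.single i 1 : Fin k → F)) p) d)
    (S : Fin t → Finset (Fin k))
    (hSne : ∀ l, (S l).Nonempty)
    (hScard : ∀ l, (S l).card ≤ r)
    (hSdisj : ∀ l l', l ≠ l' → Disjoint (S l) (S l'))
    (hScover : Finset.univ.biUnion S = Finset.univ) :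
    ∀ c : Fin k ⊕ (Fin t ⊕ Fin (d - 2)) → Fin k → F,
      c = Sum.elim (fun i : Fin k => (Pi.single i 1 : Fin k → F))
            (Sum.elim
              (fun l : Fin t => fun j : Fin k =>
                if j ∈ S l then p ⟨0, by omega⟩ j else 0)
              (fun m : Fin (d - 2) => p ⟨m.val + 1, by have := m.isLt; omega⟩)) →
      -- the pyramid code is a linear [k + ⌈k/r⌉ + (d−2), k, d] code
      Fintype.card (Fin k ⊕ (Fin t ⊕ Fin (d - 2))) = k + (k + r - 1) / r + d - 2 ∧
      Submodule.span F (Set.range c) = ⊤ ∧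
      HasDistance c d ∧
      -- it has information locality r
      InfoLocality c r ∧
      -- its first k + ⌈k/r⌉ coordinates all have locality at most r
      (∀ i : Fin k, LocLE c (Sum.inl i) r) ∧
      (∀ l : Fin t, LocLE c (Sum.inr (Sum.inl l)) r) := by
  rintro c rfl
  obtain ⟨n, rfl⟩ : ∃ n, d = n + 2 := ⟨d - 2, by omega⟩
  have hS : ∀ j, ∃! l, j ∈ S l := by
    intro j
    obtain ⟨l, -, hl⟩ := Finset.mem_biUnion.1 (hScover ▸ Finset.mem_univ j)
    refine ⟨l, hl, fun l' hl' => ?_⟩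
    by_contra hne
    exact Finset.disjoint_left.1 (hSdisj l' l hne) hl' hl
  change Fin (n + 1) → Fin k → F at p
  set c : Fin k ⊕ (Fin t ⊕ Fin n) → Fin k → F :=
    Sum.elim (fun i => Pi.single i 1)
      (Sum.elim (fun l => restrictCoords (S l) (p 0)) (fun m => p m.succ)) with hc
  change Fintype.card (Fin k ⊕ (Fin t ⊕ Fin n)) = _ ∧ Submodule.span F (Set.range c) = ⊤ ∧
    HasDistance c (n + 2) ∧ InfoLocality c r ∧ (∀ i : Fin k, LocLE c (Sum.inl i) r) ∧
    (∀ l : Fin t, LocLE c (Sum.inr (Sum.inl l)) r)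
  have hp : ∀ i, p 0 i ≠ 0 :=
    parity_apply_ne_zero p (fun x hx => by rw [Fintype.card_fin]; exact hE.1 x hx) 0
  have hinl : ∀ i, c (Sum.inl i) = Pi.single i 1 := fun _ => rfl
  have hspan : Submodule.span F (c '' Set.range Sum.inl) = ⊤ := by
    rw [← Set.range_comp]
    exact span_range_single
  have hloc : ∀ i : Fin k, LocLE c (Sum.inl i) r := fun i =>
    let ⟨l, hl, _⟩ := hS i
    (locLE_single c hinl (l := Sum.inl l) rfl hl (hp i)).mono (hScard l)
  have hle : ∀ x : Fin k → F, x ≠ 0 → n + 2 ≤ codewordWeight c x := by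
    intro x hx
    have h := hE.1 x hx
    have h' := le_codewordWeight_restrictCoords hS (p 0) x
    rw [codewordWeight_sumElim, codewordWeight_fin_succ] at h
    rw [hc, codewordWeight_sumElim, codewordWeight_sumElim]
    omega
  refine ⟨?_, ?_, ⟨hle, ?_⟩, ⟨Set.range Sum.inl, hspan, ?_⟩, hloc, fun l => ?_⟩
  · simp only [Fintype.card_sum, Fintype.card_fin, ← ht]
    omega
  · exact top_le_iff.1 (hspan ▸ Submodule.span_mono (Set.image_subset_range _ _))
  · have hne : (Pi.single ⟨0, hk⟩ 1 : Fin k → F) ≠ 0 := by simp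
    refine ⟨Pi.single ⟨0, hk⟩ 1, hne, (hle _ hne).antisymm' ?_⟩
    have h₁ := codewordWeight_restrictCoords_single_le hS (p 0) ⟨0, hk⟩
    have h₂ := codewordWeight_le_card (fun m : Fin n => p m.succ) (Pi.single ⟨0, hk⟩ 1)
    rw [Fintype.card_fin] at h₂
    rw [hc, codewordWeight_sumElim, codewordWeight_sumElim, codewordWeight_basis_single]
    omega
  · rintro _ ⟨i, rfl⟩
    exact hloc i
  · exact (locLE_restrictCoords c hinl (l := Sum.inl l) rfl).mono (hScard l)
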